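/- arXiv:2406.10865 — 2 statements merged into one kernel-verified Lean document; each statement's English description precedes it below -/
import Mathlib

section
/- Let δ > 0 and γ > 1/2 + δ. There is a constant C depending only on γ and δ such that the following holds. Let 0 < T ≤ 1, λ ≥ 10, set N₁ = λ T^{−1/2}, and let a ∈ L^∞([0,T]; H^γ). Then for every t ∈ [0,T]: ‖ |ξ|^{1/2+δ} e^{−λ²t/(4T) + λ(t/√T)|ξ|} 1_{|ξ| < 0.01 N₁} â(t,ξ) ‖_{L²_ξ} ≤ C ( 1 + λ^{1/2+δ+γ} T^{(γ−1/2−δ)/2} e^{0.01 λ²} ) e^{−λ² t/(4T)} ‖a‖_{L^∞_T(H^γ)}. -/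
noncomputable section

open MeasureTheory Set Filter
open scoped ENNReal Topology

/-- Frequency space ℝ³ (as functions `Fin 3 → ℝ`, with the product Lebesgue measure). -/
abbrev V3 : Type := Fin 3 → ℝ

/-- The Euclidean norm on `V3`. -/
def en (ξ : V3) : ℝ := Real.sqrt (∑ i, ξ i ^ 2)

/-- Squared Euclidean magnitude of a vector in ℂ³. -/
def vnSq (v : Fin 3 → ℂ) : ℝ := ∑ j, ‖v j‖ ^ 2

/-- Weighted L²-norm in the frequency variable, valued in `ℝ≥0∞`:
`wnorm w f = ( ∫ (w ξ)² |f ξ|² dξ )^{1/2}`. -/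
def wnorm (w : V3 → ℝ) (f : V3 → Fin 3 → ℂ) : ℝ≥0∞ :=
  (∫⁻ ξ : V3, ENNReal.ofReal (w ξ ^ 2 * vnSq (f ξ))) ^ ((1 : ℝ) / 2)

/-- Weight of the inhomogeneous Sobolev norm `H^γ`, i.e. `⟨ξ⟩^γ`. -/
def wH (γ : ℝ) : V3 → ℝ := fun ξ => (1 + en ξ ^ 2) ^ (γ / 2)

/-- Weight of the homogeneous Sobolev norm `Ḣ^s`, i.e. `|ξ|^s`. -/
def wD (s : ℝ) : V3 → ℝ := fun ξ => en ξ ^ s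

/-- Coefficients `α^{j,m,n,p}_{k,ℓ}` of the bilinear form `Q`
(order of arguments: `α j m n p k l`). -/
abbrev Coeffs : Type := Fin 3 → Fin 3 → Fin 3 → Fin 3 → Fin 3 → Fin 3 → ℝ

/-- The symbol `q^{j,m}_{k,ℓ}(ξ) = Σ_{n,p} α^{j,m,n,p}_{k,ℓ} ξ_n ξ_p / |ξ|²`. -/
def qsym (α : Coeffs) (j m k l : Fin 3) (ξ : V3) : ℝ :=
  ∑ n, ∑ p, α j m n p k l * (ξ n * ξ p) / en ξ ^ 2

/-- Fourier side of the bilinear term `Q(u,v)`: with the convention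
`f̂(ξ) = ∫ f(x) e^{-ix·ξ} dx`, the product `u^k v^ℓ` has Fourier transform
`(2π)⁻³ (û^k ∗ v̂^ℓ)(ξ)`, so that
`(Q^j(u,v))^(ξ) = Σ_{k,ℓ,m} q^{j,m}_{k,ℓ}(ξ) · iξ_m · (2π)⁻³ (û^k ∗ v̂^ℓ)(ξ)`. -/
def Qhat (α : Coeffs) (U W : V3 → Fin 3 → ℂ) : V3 → Fin 3 → ℂ := fun ξ j =>
  ∑ k : Fin 3, ∑ l : Fin 3, ∑ m : Fin 3,
    (qsym α j m k l ξ : ℂ) * (Complex.I * (ξ m : ℂ)) *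
      ((((2 * Real.pi) ^ (3 : ℕ))⁻¹ : ℝ) : ℂ) * ∫ η : V3, U η k * W (ξ - η) l

/-- `U` is (the Fourier transform of) a mild solution of the generalized Navier–Stokes
equations on `[0,T]` with (Fourier-side) data `U₀`:
`û(t,ξ) = e^{-t|ξ|²} û₀(ξ) + ∫₀^t e^{-(t-s)|ξ|²} (Q(u,u))^(s,ξ) ds`. -/
def IsMildSol (α : Coeffs) (U₀ : V3 → Fin 3 → ℂ) (U : ℝ → V3 → Fin 3 → ℂ) (T : ℝ) : Prop :=
  ∀ t ∈ Icc (0 : ℝ) T, ∀ ξ : V3, ∀ j : Fin 3,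
    U t ξ j = (Real.exp (-(t * en ξ ^ 2)) : ℂ) * U₀ ξ j
      + ∫ s in (0 : ℝ)..t, (Real.exp (-((t - s) * en ξ ^ 2)) : ℂ) * Qhat α (U s) (U s) ξ j

/-- Continuity on `[0,T]` with values in the weighted L²-space with weight `w`
(this encodes `u ∈ C([0,T]; H)` for the corresponding Sobolev space `H`). -/
def ContInW (w : V3 → ℝ) (U : ℝ → V3 → Fin 3 → ℂ) (T : ℝ) : Prop :=
  (∀ t ∈ Icc (0 : ℝ) T, wnorm w (U t) < ⊤) ∧
  ∀ t ∈ Icc (0 : ℝ) T, ∀ ε : ℝ≥0∞, 0 < ε → ∃ d > (0 : ℝ), ∀ s ∈ Icc (0 : ℝ) T,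
    |s - t| < d → wnorm w (fun ξ j => U s ξ j - U t ξ j) < ε

/-- Membership in `L²((0,T); H)` for the weighted space `H` with weight `w`. -/
def MemL2W (w : V3 → ℝ) (U : ℝ → V3 → Fin 3 → ℂ) (T : ℝ) : Prop :=
  ∫⁻ t in Ioo (0 : ℝ) T, wnorm w (U t) ^ (2 : ℕ) < ⊤

/-- Joint measurability of a time-dependent (Fourier-side) vector field. -/
def MeasVF (U : ℝ → V3 → Fin 3 → ℂ) : Prop :=
  ∀ j : Fin 3, Measurable (Function.uncurry fun t ξ => U t ξ j)

/-- Divergence-free condition on the Fourier side: `ξ · û₀(ξ) = 0`. -/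
def DivFree (U₀ : V3 → Fin 3 → ℂ) : Prop := ∀ ξ : V3, ∑ j : Fin 3, (ξ j : ℂ) * U₀ ξ j = 0

/-- `U₀` is the Fourier transform of a real (ℝ³-valued) vector field. -/
def RealField (U₀ : V3 → Fin 3 → ℂ) : Prop :=
  ∀ ξ : V3, ∀ j : Fin 3, U₀ (-ξ) j = (starRingEnd ℂ) (U₀ ξ j)

theorem vnSq_nonneg (v : Fin 3 → ℂ) : 0 ≤ vnSq v :=
  Finset.sum_nonneg fun _ _ => sq_nonneg _

theorem en_nonneg (ξ : V3) : 0 ≤ en ξ := Real.sqrt_nonneg _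

/-- A pointwise comparison of weights yields a comparison of weighted norms. -/
theorem wnorm_le_of_weight_le {w w' : V3 → ℝ} {K : ℝ} (hK : 0 ≤ K) (hw : ∀ ξ, 0 ≤ w ξ)
    (h : ∀ ξ, w ξ ≤ K * w' ξ) (f : V3 → Fin 3 → ℂ) :
    wnorm w f ≤ ENNReal.ofReal K * wnorm w' f := by
  have hint : (∫⁻ ξ : V3, ENNReal.ofReal (w ξ ^ 2 * vnSq (f ξ)))
      ≤ ENNReal.ofReal (K ^ 2) * ∫⁻ ξ : V3, ENNReal.ofReal (w' ξ ^ 2 * vnSq (f ξ)) := by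
    rw [← lintegral_const_mul' _ _ ENNReal.ofReal_ne_top]
    refine lintegral_mono fun ξ => ?_
    rw [← ENNReal.ofReal_mul (sq_nonneg K)]
    refine ENNReal.ofReal_le_ofReal ?_
    rw [← mul_assoc, ← mul_pow]
    exact mul_le_mul_of_nonneg_right (pow_le_pow_left₀ (hw ξ) (h ξ) 2) (vnSq_nonneg _)
  unfold wnorm
  refine (ENNReal.rpow_le_rpow hint (by norm_num)).trans_eq ?_
  rw [ENNReal.mul_rpow_of_nonneg _ _ (by norm_num),
    ENNReal.ofReal_rpow_of_nonneg (sq_nonneg K) (by norm_num), ← Real.sqrt_eq_rpow,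
    Real.sqrt_sq hK]

/-- A power `r ^ s` is dominated by the Japanese bracket to any power `γ ≥ s`. -/
theorem rpow_le_one_add_sq_rpow {r s γ : ℝ} (hr : 0 ≤ r) (hs : 0 ≤ s) (hsγ : s ≤ γ) :
    r ^ s ≤ (1 + r ^ 2) ^ (γ / 2) := by
  calc r ^ s = (r ^ 2) ^ (s / 2) := by
        rw [← Real.rpow_natCast, ← Real.rpow_mul hr]
        congr 1
        push_cast
        ring
    _ ≤ (1 + r ^ 2) ^ (s / 2) := by gcongr; linarith
    _ ≤ (1 + r ^ 2) ^ (γ / 2) :=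
        Real.rpow_le_rpow_of_exponent_le (by nlinarith [sq_nonneg r]) (by linarith)

theorem exp_mul_rpow_le_of_lt {s γ T lam t r : ℝ} (hs : 0 ≤ s) (hsγ : s ≤ γ) (hT : 0 < T)
    (hlam : 1 ≤ lam) (ht : t ∈ Icc (0 : ℝ) T) (hr : 0 ≤ r)
    (hrlow : r < 0.01 * (lam * T ^ (-(1 : ℝ) / 2))) :
    Real.exp (lam * t / Real.sqrt T * r) * r ^ s ≤
      Real.exp 1 * (1 + lam ^ (s + γ) * T ^ ((γ - s) / 2) * Real.exp (0.01 * lam ^ 2)) *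
        (1 + r ^ 2) ^ (γ / 2) := by
  have hlam0 : 0 < lam := by linarith
  have hq : 0 < Real.sqrt T := Real.sqrt_pos.2 hT
  have hqq : Real.sqrt T * Real.sqrt T = T := Real.mul_self_sqrt hT.le
  have hTq : T ^ (-(1 : ℝ) / 2) = (Real.sqrt T)⁻¹ := by
    rw [Real.sqrt_eq_rpow, ← Real.rpow_neg hT.le]
    norm_num
  have hphase : lam * t / Real.sqrt T * r ≤ lam * Real.sqrt T * r := by
    refine mul_le_mul_of_nonneg_right ?_ hr
    rw [div_le_iff₀ hq, mul_assoc, hqq]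
    exact mul_le_mul_of_nonneg_left ht.2 hlam0.le
  have hB : 0 ≤ lam ^ (s + γ) * T ^ ((γ - s) / 2) * Real.exp (0.01 * lam ^ 2) := by positivity
  have hJ : 0 ≤ (1 + r ^ 2) ^ (γ / 2) := by positivity
  rcases le_or_gt (lam * Real.sqrt T * r) 1 with hsmall | hlarge
  · calc Real.exp (lam * t / Real.sqrt T * r) * r ^ s
        ≤ Real.exp 1 * (1 + r ^ 2) ^ (γ / 2) := by
          gcongr
          · exact hphase.trans hsmall
          · exact rpow_le_one_add_sq_rpow hr hs hsγ
      _ ≤ _ := by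
          refine mul_le_mul_of_nonneg_right ?_ hJ
          exact le_mul_of_one_le_right (Real.exp_nonneg 1) (by linarith)
  · have hr0 : 0 < r := by
      rcases hr.eq_or_lt with rfl | h
      · norm_num at hlarge
      · exact h
    have hphase' : lam * Real.sqrt T * r ≤ 0.01 * lam ^ 2 := by
      rw [hTq] at hrlow
      calc lam * Real.sqrt T * r
          ≤ lam * Real.sqrt T * (0.01 * (lam * (Real.sqrt T)⁻¹)) := by gcongr
        _ = 0.01 * lam ^ 2 := by field_simp
    have hpow : r ^ s ≤ lam ^ (s + γ) * T ^ ((γ - s) / 2) * (1 + r ^ 2) ^ (γ / 2) := by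
      calc r ^ s ≤ (lam * Real.sqrt T * r) ^ (γ - s) * r ^ s :=
            le_mul_of_one_le_left (by positivity)
              (Real.one_le_rpow hlarge.le (by linarith))
        _ = lam ^ (γ - s) * T ^ ((γ - s) / 2) * r ^ γ := by
            rw [Real.mul_rpow (by positivity) hr, Real.mul_rpow hlam0.le hq.le, mul_assoc,
              ← Real.rpow_add hr0, Real.sqrt_eq_rpow, ← Real.rpow_mul hT.le]
            congr 3 <;> ring
        _ ≤ _ := by
            gcongr ?_ * _ * ?_
            · exact Real.rpow_le_rpow_of_exponent_le hlam (by linarith)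
            · exact rpow_le_one_add_sq_rpow hr (hs.trans hsγ) le_rfl
    calc Real.exp (lam * t / Real.sqrt T * r) * r ^ s
        ≤ Real.exp (0.01 * lam ^ 2) *
            (lam ^ (s + γ) * T ^ ((γ - s) / 2) * (1 + r ^ 2) ^ (γ / 2)) := by
          gcongr Real.exp ?_ * ?_
          exact hphase.trans hphase'
      _ = lam ^ (s + γ) * T ^ ((γ - s) / 2) * Real.exp (0.01 * lam ^ 2) *
            (1 + r ^ 2) ^ (γ / 2) := by ring
      _ ≤ _ := by
          refine mul_le_mul_of_nonneg_right ?_ hJ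
          refine le_trans ?_ (le_mul_of_one_le_left (by linarith) (Real.one_le_exp zero_le_one))
          linarith

/-- Lemma 2.1: low-frequency Gevrey bound. -/
theorem statement2 (γ δ : ℝ) (hδ : 0 < δ) (hγ : 1 / 2 + δ < γ) :
    ∃ C > (0 : ℝ), ∀ T lam : ℝ, 0 < T → T ≤ 1 → 10 ≤ lam →
      ∀ A : ℝ → V3 → Fin 3 → ℂ, MeasVF A →
        (⨆ s ∈ Icc (0 : ℝ) T, wnorm (wH γ) (A s)) < ⊤ →
        ∀ t ∈ Icc (0 : ℝ) T,
          wnorm (fun ξ => if en ξ < 0.01 * (lam * T ^ (-(1 : ℝ) / 2)) then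
                Real.exp (-(lam ^ 2 * t / (4 * T)) + lam * t / Real.sqrt T * en ξ) *
                  en ξ ^ (1 / 2 + δ)
              else 0) (A t)
            ≤ ENNReal.ofReal (C *
                  (1 + lam ^ (1 / 2 + δ + γ) * T ^ ((γ - 1 / 2 - δ) / 2) *
                    Real.exp (0.01 * lam ^ 2)) *
                  Real.exp (-(lam ^ 2 * t / (4 * T)))) *
              ⨆ s ∈ Icc (0 : ℝ) T, wnorm (wH γ) (A s) := by
  refine ⟨Real.exp 1, Real.exp_pos 1, fun T lam hT _ hlam A _ _ t ht => ?_⟩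
  refine le_trans (wnorm_le_of_weight_le (w' := wH γ) (by positivity) (fun ξ => ?_)
    (fun ξ => ?_) (A t)) (mul_le_mul_right (le_iSup₂ (f := fun s _ => wnorm (wH γ) (A s)) t ht) _)
  · have := en_nonneg ξ
    split_ifs <;> positivity
  · have hen := en_nonneg ξ
    unfold wH
    split_ifs with hlow
    · have key := exp_mul_rpow_le_of_lt (s := 1 / 2 + δ) (by linarith) hγ.le hT
        (by linarith) ht hen hlow
      rw [Real.exp_add, show γ - 1 / 2 - δ = γ - (1 / 2 + δ) by ring]
      refine le_of_eq_of_le (by ring)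
        ((mul_le_mul_of_nonneg_left key (Real.exp_nonneg (-(lam ^ 2 * t / (4 * T))))).trans_eq ?_)
      ring
    · positivity
end
end

section
/- Let δ > 0 and γ > 1/2 + δ. There is a constant C depending only on γ and δ such that for all 0 < T ≤ 1, λ ≥ 1, N₁ = λ T^{−1/2}, every t ∈ [0,T] and every a ∈ L^∞([0,T]; H^γ): ‖ 1_{0.01N₁ ≤ |ξ| ≤ 0.1N₁} t^{δ/2} |ξ|^{δ+1/2} e^{−λ²t/(4T) + λ(t/√T)|ξ|} â(t,ξ) ‖_{L²_ξ} ≤ C T^{(γ−1/2)/2} λ^{−(γ−1/2−δ)} ‖a_h‖_{L^∞_T(H^γ)}, where â_h(t,ξ) = â(t,ξ)·1_{|ξ| ≥ 0.01N₁}. -/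
noncomputable section

open MeasureTheory Set Filter
open scoped ENNReal Topology

/-- Pointwise domination of the weights gives domination of the weighted norms. -/
lemma wnorm_le_const_mul {w w' : V3 → ℝ} {K : ℝ} (hK : 0 ≤ K) (h : ∀ ξ, |w ξ| ≤ K * |w' ξ|)
    (f : V3 → Fin 3 → ℂ) : wnorm w f ≤ ENNReal.ofReal K * wnorm w' f := by
  have hsq : ∀ ξ, w ξ ^ 2 ≤ K ^ 2 * w' ξ ^ 2 := fun ξ => by
    have := pow_le_pow_left₀ (abs_nonneg _) (h ξ) 2
    rwa [mul_pow, sq_abs, sq_abs] at this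
  have hint : (∫⁻ ξ : V3, ENNReal.ofReal (w ξ ^ 2 * vnSq (f ξ)))
      ≤ ENNReal.ofReal (K ^ 2) * ∫⁻ ξ : V3, ENNReal.ofReal (w' ξ ^ 2 * vnSq (f ξ)) := by
    rw [← lintegral_const_mul' _ _ ENNReal.ofReal_ne_top]
    refine lintegral_mono fun ξ => ?_
    rw [← ENNReal.ofReal_mul (sq_nonneg K), ← mul_assoc]
    have hv : 0 ≤ vnSq (f ξ) := Finset.sum_nonneg fun j _ => sq_nonneg _
    exact ENNReal.ofReal_le_ofReal (mul_le_mul_of_nonneg_right (hsq ξ) hv)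
  have hroot : ENNReal.ofReal (K ^ 2) ^ ((1 : ℝ) / 2) = ENNReal.ofReal K := by
    rw [ENNReal.ofReal_rpow_of_nonneg (sq_nonneg K) (by norm_num), ← Real.sqrt_eq_rpow,
      Real.sqrt_sq hK]
  unfold wnorm
  calc _ ≤ _ := ENNReal.rpow_le_rpow hint (by norm_num)
    _ = _ := by rw [ENNReal.mul_rpow_of_nonneg _ _ (by norm_num), hroot]

lemma rpow_mul_exp_neg_le {a b x : ℝ} (ha : 0 < a) (hb : 0 < b) (hx : 0 ≤ x) :
    x ^ a * Real.exp (-(b * x)) ≤ (a / b) ^ a := by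
  have h1 : x ≤ a / b * Real.exp (b * x / a) := by
    have h2 : b * x / a ≤ Real.exp (b * x / a) := by
      linarith [Real.add_one_le_exp (b * x / a)]
    calc x = a / b * (b * x / a) := by field_simp
      _ ≤ _ := by gcongr
  have h3 : x ^ a ≤ (a / b) ^ a * Real.exp (b * x) := by
    calc x ^ a ≤ (a / b * Real.exp (b * x / a)) ^ a := Real.rpow_le_rpow hx h1 ha.le
      _ = _ := by
        rw [Real.mul_rpow (by positivity) (by positivity), ← Real.exp_mul]
        congr 2
        field_simp
  rw [Real.exp_neg, ← div_eq_mul_inv]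
  exact (div_le_iff₀ (Real.exp_pos _)).2 h3

/-- The weight on the band `0.01 N ≤ r ≤ 0.1 N`, in terms of `N` alone. -/
lemma band_weight_le {γ δ N t r : ℝ} (hδ : 0 < δ) (hγ : 1 / 2 + δ < γ) (hN : 0 < N) (ht : 0 ≤ t)
    (h1 : 0.01 * N ≤ r) (h2 : r ≤ 0.1 * N) :
    t ^ (δ / 2) * r ^ (δ + 1 / 2) * Real.exp (-(N ^ 2 * t / 4) + N * t * r) ≤
      (δ / 2 / 0.15) ^ (δ / 2) * 0.01 ^ (δ + 1 / 2 - γ) * N ^ (1 / 2 - γ) *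
        (1 + r ^ 2) ^ (γ / 2) := by
  have hr : 0 < r := by linarith
  have hexp : Real.exp (-(N ^ 2 * t / 4) + N * t * r) ≤ Real.exp (-(0.15 * (t * N ^ 2))) := by
    apply Real.exp_le_exp.2
    nlinarith [mul_le_mul_of_nonneg_left h2 (mul_nonneg hN.le ht)]
  have htime : t ^ (δ / 2) * Real.exp (-(0.15 * (t * N ^ 2))) ≤
      (δ / 2 / 0.15) ^ (δ / 2) * N ^ (-δ) := by
    have h := rpow_mul_exp_neg_le (a := δ / 2) (b := 0.15) (x := t * N ^ 2) (by positivity)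
      (by norm_num) (by positivity)
    rw [Real.mul_rpow ht (by positivity), ← Real.rpow_natCast_mul hN.le] at h
    have h' : N ^ (((2 : ℕ) : ℝ) * (δ / 2)) = N ^ δ := by congr 1; push_cast; ring
    rw [h'] at h
    rw [Real.rpow_neg hN.le, ← div_eq_mul_inv, le_div_iff₀ (by positivity)]
    linarith
  have hfreq : r ^ (δ + 1 / 2) ≤
      0.01 ^ (δ + 1 / 2 - γ) * N ^ (δ + 1 / 2 - γ) * (1 + r ^ 2) ^ (γ / 2) := by
    have hs : r ^ γ ≤ (1 + r ^ 2) ^ (γ / 2) := by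
      have : r ^ γ = (r ^ 2) ^ (γ / 2) := by
        rw [← Real.rpow_natCast_mul hr.le]
        congr 1; push_cast; ring
      rw [this]
      exact Real.rpow_le_rpow (by positivity) (by linarith) (by linarith)
    have hlow : r ^ (δ + 1 / 2 - γ) ≤ (0.01 * N) ^ (δ + 1 / 2 - γ) :=
      Real.rpow_le_rpow_of_nonpos (by positivity) h1 (by linarith)
    rw [← Real.mul_rpow (by norm_num) hN.le]
    calc r ^ (δ + 1 / 2) = r ^ (δ + 1 / 2 - γ) * r ^ γ := by
          rw [← Real.rpow_add hr]; congr 1; ring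
      _ ≤ _ := by gcongr
  calc _ ≤ t ^ (δ / 2) * r ^ (δ + 1 / 2) * Real.exp (-(0.15 * (t * N ^ 2))) := by gcongr
    _ = (t ^ (δ / 2) * Real.exp (-(0.15 * (t * N ^ 2)))) * r ^ (δ + 1 / 2) := by ring
    _ ≤ ((δ / 2 / 0.15) ^ (δ / 2) * N ^ (-δ)) *
        (0.01 ^ (δ + 1 / 2 - γ) * N ^ (δ + 1 / 2 - γ) * (1 + r ^ 2) ^ (γ / 2)) := by gcongr
    _ = (δ / 2 / 0.15) ^ (δ / 2) * 0.01 ^ (δ + 1 / 2 - γ) * (N ^ (-δ) * N ^ (δ + 1 / 2 - γ)) *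
        (1 + r ^ 2) ^ (γ / 2) := by ring
    _ = _ := by rw [← Real.rpow_add hN]; congr 3; ring

/-- bound on the intermediate frequency band `0.01N₁ ≤ |ξ| ≤ 0.1N₁`. -/
theorem statement3 (γ δ : ℝ) (hδ : 0 < δ) (hγ : 1 / 2 + δ < γ) :
    ∃ C > (0 : ℝ), ∀ T lam : ℝ, 0 < T → T ≤ 1 → 1 ≤ lam →
      ∀ A : ℝ → V3 → Fin 3 → ℂ, MeasVF A →
        (⨆ s ∈ Icc (0 : ℝ) T, wnorm (wH γ) (A s)) < ⊤ →
        ∀ t ∈ Icc (0 : ℝ) T,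
          wnorm (fun ξ =>
              if 0.01 * (lam * T ^ (-(1 : ℝ) / 2)) ≤ en ξ ∧
                  en ξ ≤ 0.1 * (lam * T ^ (-(1 : ℝ) / 2)) then
                t ^ (δ / 2) * en ξ ^ (δ + 1 / 2) *
                  Real.exp (-(lam ^ 2 * t / (4 * T)) + lam * t / Real.sqrt T * en ξ)
              else 0) (A t)
            ≤ ENNReal.ofReal (C * T ^ ((γ - 1 / 2) / 2) * lam ^ (-(γ - 1 / 2 - δ))) *
              ⨆ s ∈ Icc (0 : ℝ) T,
                wnorm (fun ξ => if 0.01 * (lam * T ^ (-(1 : ℝ) / 2)) ≤ en ξ then wH γ ξ else 0)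
                  (A s) := by
  refine ⟨(δ / 2 / 0.15) ^ (δ / 2) * 0.01 ^ (δ + 1 / 2 - γ), by positivity, ?_⟩
  intro T lam hT _ hlam A _ _ t ht
  have hlam0 : 0 < lam := by linarith
  set N : ℝ := lam * T ^ (-(1 : ℝ) / 2) with hNdef
  have hN : 0 < N := by positivity
  have hsqrt : N = lam / Real.sqrt T := by
    rw [hNdef, Real.sqrt_eq_rpow, neg_div, Real.rpow_neg hT.le, div_eq_mul_inv lam]
  have hNsq : N ^ 2 = lam ^ 2 / T := by rw [hsqrt, div_pow, Real.sq_sqrt hT.le]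
  have hNpow : N ^ (1 / 2 - γ) ≤ T ^ ((γ - 1 / 2) / 2) * lam ^ (-(γ - 1 / 2 - δ)) := by
    rw [hNdef, Real.mul_rpow hlam0.le (by positivity), ← Real.rpow_mul hT.le, mul_comm]
    have : -(1 : ℝ) / 2 * (1 / 2 - γ) = (γ - 1 / 2) / 2 := by ring
    rw [this]
    gcongr
    linarith
  refine (wnorm_le_const_mul (by positivity) (fun ξ => ?_) (A t)).trans
    (mul_le_mul_right (le_iSup₂ (f := fun s (_ : s ∈ Icc (0 : ℝ) T) =>
      wnorm (fun ξ => if 0.01 * N ≤ en ξ then wH γ ξ else 0) (A s)) t ht) _)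
  by_cases h : 0.01 * N ≤ en ξ ∧ en ξ ≤ 0.1 * N
  · have hen : 0 ≤ en ξ := Real.sqrt_nonneg _
    have ht0 := ht.1
    have hphase : -(lam ^ 2 * t / (4 * T)) + lam * t / Real.sqrt T * en ξ =
        -(N ^ 2 * t / 4) + N * t * en ξ := by
      rw [hNsq, hsqrt]
      field_simp
    rw [if_pos h, if_pos h.1, wH, hphase, abs_of_nonneg (by positivity),
      abs_of_nonneg (by positivity)]
    refine (band_weight_le hδ hγ hN ht0 h.1 h.2).trans ?_
    rw [mul_assoc (_ * _) (T ^ _)]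
    gcongr
  · rw [if_neg h, abs_zero]
    positivity
end
end
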